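/- Let ρ > 1 and λ ∈ ℂ. Then, as n → ∞, the functions ζ ↦ (1 + (2/(ρn))^{1/2} ζ)^{−n} · (E_{1/ρ}(R_n))^{−1} · I_n(R_n (1 + (2/(ρn))^{1/2} ζ); λ) converge to the function ζ ↦ e^{ζ²}·(erfc(ζ)/2 − λ), uniformly on every compact subset of the complex ζ-plane. -/

import Mathlib

open Complex Real Filter Topology

/-- `R_n = Γ(1+n/ρ)/Γ(1+(n-1)/ρ)`. -/
noncomputable def Rn (ρ : ℝ) (n : ℕ) : ℝ :=
  Real.Gamma (1 + (n : ℝ) / ρ) / Real.Gamma (1 + ((n : ℝ) - 1) / ρ)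

/-- The section `s_n(w) = Σ_{k=0}^n w^k/Γ(1+k/ρ)`. -/
noncomputable def mlSec (ρ : ℝ) (n : ℕ) (w : ℂ) : ℂ :=
  ∑ k ∈ Finset.range (n + 1), w ^ k / (Real.Gamma (1 + (k : ℝ) / ρ) : ℂ)

/-- The tail `t_m(w) = Σ_{k=m}^∞ w^k/Γ(1+k/ρ)`. -/
noncomputable def mlTail (ρ : ℝ) (m : ℕ) (w : ℂ) : ℂ :=
  ∑' k : ℕ, w ^ (m + k) / (Real.Gamma (1 + ((m + k : ℕ) : ℝ) / ρ) : ℂ)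

/-- `I_n(w; λ) = (1-λ) s_n(w) - λ t_{n+1}(w)`. -/
noncomputable def mlI (ρ : ℝ) (lam : ℂ) (n : ℕ) (w : ℂ) : ℂ :=
  (1 - lam) * mlSec ρ n w - lam * mlTail ρ (n + 1) w

/-- The Mittag–Leffler function `E_{1/ρ}(z) = Σ_{j=0}^∞ z^j/Γ(1+j/ρ)`. -/
noncomputable def mlE (ρ : ℝ) (z : ℂ) : ℂ :=
  ∑' j : ℕ, z ^ j / (Real.Gamma (1 + (j : ℝ) / ρ) : ℂ)

/-- The complementary error function `erfc(ζ) = 1 - (2/√π) ∫₀^ζ e^{-v²} dv`,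
the integral taken along the segment from `0` to `ζ`. -/
noncomputable def erfc (ζ : ℂ) : ℂ :=
  1 - ((2 / Real.sqrt π : ℝ) : ℂ) * ∫ t in (0:ℝ)..1, ζ * Complex.exp (-((t : ℂ) * ζ) ^ 2)

open MeasureTheory

/-- Wendel's bounds for the logarithm of a ratio of Gamma values. -/
lemma log_Gamma_add_sub_bounds {s y : ℝ} (hs : 0 < s) (hs1 : s < 1) (hy : 0 < y) :
    s * Real.log y - 1 / y ≤ Real.log (Real.Gamma (y + s)) - Real.log (Real.Gamma y) ∧
      Real.log (Real.Gamma (y + s)) - Real.log (Real.Gamma y) ≤ s * Real.log y := by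
  have hconv := Real.convexOn_log_Gamma.2
  have hys : 0 < y + s := by positivity
  have hG : ∀ t : ℝ, 0 < t →
      Real.log (Real.Gamma (t + 1)) = Real.log t + Real.log (Real.Gamma t) := fun t ht => by
    rw [Real.Gamma_add_one ht.ne', Real.log_mul ht.ne' (Real.Gamma_pos_of_pos ht).ne']
  have upper := hconv (x := y) hy (y := y + 1) (by simp; positivity)
    (a := 1 - s) (b := s) (by linarith) hs.le (by ring)
  have lower := hconv (x := y + s) hys (y := y + s + 1) (by simp; positivity)
    (a := s) (b := 1 - s) hs.le (by linarith) (by ring)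
  simp only [smul_eq_mul, Function.comp_apply] at upper lower
  rw [show (1 - s) * y + s * (y + 1) = y + s by ring, hG y hy] at upper
  rw [show s * (y + s) + (1 - s) * (y + s + 1) = y + 1 by ring, hG y hy, hG _ hys] at lower
  have hlog : Real.log (y + s) ≤ Real.log y + s / y := by
    have h := Real.log_le_sub_one_of_pos (x := (y + s) / y) (by positivity)
    rw [Real.log_div hys.ne' hy.ne'] at h
    have : (y + s) / y - 1 = s / y := by field_simp; ring
    linarith
  have h1 : (1 - s) * Real.log (y + s) ≤ (1 - s) * (Real.log y + s / y) :=
    mul_le_mul_of_nonneg_left hlog (by linarith)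
  have h2 : (1 - s) * (s / y) ≤ 1 / y := by
    rw [← mul_div_assoc]
    gcongr
    nlinarith
  constructor <;> nlinarith

lemma Rn_pos {ρ : ℝ} (hρ : 1 < ρ) (n : ℕ) : 0 < Rn ρ n := by
  have h0 : 0 < ρ := by linarith
  have h1 : ((n : ℝ) - 1) / ρ = n / ρ - 1 / ρ := by ring
  have h2 : 1 / ρ < 1 := by rw [div_lt_one h0]; exact hρ
  have h3 : 0 ≤ (n : ℝ) / ρ := by positivity
  exact div_pos (Real.Gamma_pos_of_pos (by linarith)) (Real.Gamma_pos_of_pos (by linarith))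

lemma Gamma_coeff_pos {ρ : ℝ} (hρ : 1 < ρ) (n : ℕ) : 0 < Real.Gamma (1 + (n : ℝ) / ρ) :=
  Real.Gamma_pos_of_pos (by have : 0 < ρ := by linarith
                            positivity)

lemma Rn_succ (ρ : ℝ) (n : ℕ) :
    Rn ρ (n + 1) = Real.Gamma (1 + ((n + 1 : ℕ) : ℝ) / ρ) / Real.Gamma (1 + (n : ℝ) / ρ) := by
  simp [Rn]

lemma Rn_mono {ρ : ℝ} (hρ : 1 < ρ) : Monotone (Rn ρ) := by
  refine monotone_nat_of_le_succ fun n => ?_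
  have h0 : 0 < ρ := by linarith
  have h1 : ((n : ℝ) - 1) / ρ = n / ρ - 1 / ρ := by ring
  have h2 : 1 / ρ < 1 := by rw [div_lt_one h0]; exact hρ
  have h3 : 0 ≤ (n : ℝ) / ρ := by positivity
  have hp : 0 < 1 / ρ := by positivity
  have hx : 0 < 1 + ((n : ℝ) - 1) / ρ := by linarith
  have hz : 0 < 1 + ((n + 1 : ℕ) : ℝ) / ρ := by positivity
  have hconv := Real.convexOn_log_Gamma.2
  have hc := hconv (x := 1 + ((n : ℝ) - 1) / ρ) hx
    (y := 1 + ((n + 1 : ℕ) : ℝ) / ρ) hz (a := 1 / 2) (b := 1 / 2) (by norm_num) (by norm_num)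
    (by norm_num)
  simp only [smul_eq_mul, Function.comp_apply] at hc
  rw [show (1 / 2 : ℝ) * (1 + ((n : ℝ) - 1) / ρ) + 1 / 2 * (1 + ((n + 1 : ℕ) : ℝ) / ρ)
    = 1 + (n : ℝ) / ρ by push_cast; ring] at hc
  rw [← Real.log_le_log_iff (Rn_pos hρ n) (Rn_pos hρ _), Rn_succ, Rn,
    Real.log_div (Gamma_coeff_pos hρ n).ne' (Real.Gamma_pos_of_pos hx).ne',
    Real.log_div (Gamma_coeff_pos hρ _).ne' (Gamma_coeff_pos hρ n).ne']
  linarith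

/-- Two-sided control of the logarithmic increments of `Rn`. -/
lemma log_Rn_sub_bounds {ρ : ℝ} (hρ : 1 < ρ) {k : ℕ} (hk : 1 ≤ k) (d : ℕ) :
    d / (ρ * k) - d / (k : ℝ) ^ 2 * (d + 1) - ρ / k ≤
        Real.log (Rn ρ (k + d)) - Real.log (Rn ρ k) ∧
      Real.log (Rn ρ (k + d)) - Real.log (Rn ρ k) ≤ d / (ρ * k) + ρ / k := by
  have h0 : 0 < ρ := by linarith
  set s := 1 / ρ with hs
  have hs0 : 0 < s := by positivity
  have hs1 : s < 1 := by rw [hs, div_lt_one h0]; exact hρ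
  have hk' : (1 : ℝ) ≤ k := by exact_mod_cast hk
  have hd : (0 : ℝ) ≤ d := by positivity
  have key : ∀ m : ℕ, 1 ≤ m → s * Real.log (1 + ((m : ℝ) - 1) * s) - 1 / (1 + ((m : ℝ) - 1) * s)
      ≤ Real.log (Rn ρ m) ∧ Real.log (Rn ρ m) ≤ s * Real.log (1 + ((m : ℝ) - 1) * s) := by
    intro m hm
    have hm' : (1 : ℝ) ≤ m := by exact_mod_cast hm
    have hy : 0 < 1 + ((m : ℝ) - 1) * s := by nlinarith
    have h := log_Gamma_add_sub_bounds hs0 hs1 hy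
    have e1 : 1 + ((m : ℝ) - 1) / ρ = 1 + ((m : ℝ) - 1) * s := by rw [hs]; ring
    have e2 : 1 + (m : ℝ) / ρ = 1 + ((m : ℝ) - 1) * s + s := by rw [hs]; ring
    rw [Rn, e1, e2, Real.log_div (Real.Gamma_pos_of_pos (by positivity)).ne'
      (Real.Gamma_pos_of_pos hy).ne']
    exact h
  have hK := key k hk
  have hM := key (k + d) (by omega)
  push_cast at hM
  set y := 1 + ((k : ℝ) - 1) * s with hy
  have e : 1 + ((k : ℝ) + d - 1) * s = y + d * s := by rw [hy]; ring
  rw [e] at hM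
  have hyk : k * s ≤ y := by rw [hy]; nlinarith
  have hyu : y + d * s ≤ (k + d) * s + 1 := by rw [hy]; nlinarith
  have hy0 : 0 < y := lt_of_lt_of_le (by positivity) hyk
  have hz0 : 0 < y + d * s := by positivity
  have hinv : 1 / y ≤ ρ / k := by
    rw [div_le_div_iff₀ hy0 (by positivity)]
    have : ρ * (k * s) ≤ ρ * y := by gcongr
    rw [hs] at this
    field_simp at this ⊢
    linarith
  have hinv2 : 1 / (y + d * s) ≤ ρ / k :=
    le_trans (by gcongr; nlinarith) hinv
  have hl : Real.log ((y + d * s) / y) = Real.log (y + d * s) - Real.log y :=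
    Real.log_div hz0.ne' hy0.ne'
  constructor
  · have h := Real.one_sub_inv_le_log_of_pos (x := (y + d * s) / y) (by positivity)
    rw [hl] at h
    have h3 : s * (1 - ((y + d * s) / y)⁻¹) ≤ s * (Real.log (y + d * s) - Real.log y) := by gcongr
    have h4 : d / (ρ * k) - d / (k : ℝ) ^ 2 * (d + 1) ≤ s * (1 - ((y + d * s) / y)⁻¹) := by
      have e5 : s * (1 - ((y + d * s) / y)⁻¹) = s * (d * s) / (y + d * s) := by
        field_simp; ring
      have e6 : d / (ρ * k) = s * d / k := by rw [hs]; field_simp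
      rw [e5, e6]
      have h7 : s * (d * s) / ((k + d) * s + 1) ≤ s * (d * s) / (y + d * s) := by gcongr
      refine le_trans ?_ h7
      have h8 : s * d / k - s * (d * s) / ((k + d) * s + 1)
          = s * d * (d * s + 1) / (k * ((k + d) * s + 1)) := by field_simp; ring
      have h9 : s * d * (d * s + 1) / (k * ((k + d) * s + 1)) ≤ s * d * (d * 1 + 1) / (k * (k * s)) := by
        gcongr
        nlinarith
      have h10 : s * d * (d * 1 + 1) / (k * (k * s)) = d / (k : ℝ) ^ 2 * (d + 1) := by
        field_simp
      linarith
    linarith [hK.2, hM.1]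
  · have h := Real.log_le_sub_one_of_pos (x := (y + d * s) / y) (by positivity)
    rw [hl] at h
    have h3 : s * (Real.log (y + d * s) - Real.log y) ≤ s * ((y + d * s) / y - 1) := by gcongr
    have h4 : s * ((y + d * s) / y - 1) ≤ d / (ρ * k) := by
      have e5 : s * ((y + d * s) / y - 1) = s * (d * s) / y := by field_simp; ring
      rw [e5]
      calc s * (d * s) / y ≤ s * (d * s) / (k * s) := by gcongr
        _ = d / (ρ * k) := by rw [hs]; field_simp
    linarith [hK.1, hM.2]

lemma hasSum_integral_floor {g : ℕ → ℂ}
    (hg : IntegrableOn (fun x : ℝ => g ⌊x⌋₊) (Set.Ioi 0)) :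
    HasSum g (∫ x in Set.Ioi (0 : ℝ), g ⌊x⌋₊) := by
  have hU : (⋃ n : ℕ, Set.Ico (n : ℝ) (n + 1)) = Set.Ici 0 := by
    ext x
    simp only [Set.mem_iUnion, Set.mem_Ico, Set.mem_Ici]
    constructor
    · rintro ⟨n, h, -⟩
      exact le_trans (by positivity) h
    · intro h
      exact ⟨⌊x⌋₊, Nat.floor_le h, Nat.lt_floor_add_one x⟩
  have hdisj : Pairwise (Function.onFun Disjoint fun n : ℕ => Set.Ico (n : ℝ) (n + 1)) := by
    intro m n hmn
    refine Set.disjoint_left.2 fun x hx hx' => hmn ?_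
    rw [← (Nat.floor_eq_iff (le_trans (by positivity) hx.1)).2 hx,
      (Nat.floor_eq_iff (le_trans (by positivity) hx.1)).2 hx']
  rw [← integrableOn_Ici_iff_integrableOn_Ioi, ← hU] at hg
  have h := hasSum_integral_iUnion (fun n : ℕ => measurableSet_Ico) hdisj hg
  rw [hU, integral_Ici_eq_integral_Ioi] at h
  convert! h using 1
  funext n
  rw [setIntegral_congr_fun (g := fun _ => g n) measurableSet_Ico fun x hx => by
    rw [(Nat.floor_eq_iff (le_trans (by positivity) hx.1)).2 hx]]
  simp

lemma hasSum_integral_floor_mul {g : ℕ → ℂ} {τ : ℝ} (hτ : 0 < τ)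
    (hg : IntegrableOn (fun x : ℝ => g ⌊τ * x⌋₊) (Set.Ioi 0)) :
    HasSum g (τ * ∫ x in Set.Ioi (0 : ℝ), g ⌊τ * x⌋₊) := by
  have hi : IntegrableOn (fun x : ℝ => g ⌊x⌋₊) (Set.Ioi 0) := by
    have := (integrableOn_Ioi_comp_mul_left_iff (fun x : ℝ => g ⌊x⌋₊) 0 hτ).1 hg
    simpa using this
  have h := hasSum_integral_floor hi
  have h2 := integral_comp_mul_left_Ioi (fun x : ℝ => g ⌊x⌋₊) 0 hτ
  rw [h2]
  have : (τ : ℂ) ≠ 0 := by exact_mod_cast hτ.ne'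
  simpa [this] using h

section LaplaceSum

variable {ι : Type*} {l : Filter ι} {τ : ι → ℝ} {r : ι → ℕ → ℝ}

lemma tendsto_prod_range_gaussian (hτ : Tendsto τ l atTop) (r0 : ∀ᶠ p in l, ∀ i, 0 ≤ r p i)
    (hr : ∀ X : ℝ, ∃ C : ℝ, ∀ᶠ p in l, ∀ i : ℕ, (i : ℝ) ≤ X * τ p →
      Real.exp (-(i / τ p ^ 2) - C / τ p ^ 2) ≤ r p i ∧
        r p i ≤ Real.exp (-(i / τ p ^ 2) + C / τ p ^ 2))
    {N : ι → ℕ} {x : ℝ} (hN : Tendsto (fun p => (N p : ℝ) / τ p) l (𝓝 x)) :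
    Tendsto (fun p => ∏ i ∈ Finset.range (N p), r p i) l (𝓝 (Real.exp (-x ^ 2 / 2))) := by
  obtain ⟨C, hC⟩ := hr (x + 1)
  have hinv : Tendsto (fun p => (τ p)⁻¹) l (𝓝 0) := hτ.inv_tendsto_atTop
  have hsum : ∀ (K t : ℝ) (n : ℕ), t ≠ 0 → ∑ i ∈ Finset.range n, (-((i : ℝ) / t ^ 2) + K / t ^ 2)
      = -((n : ℝ) / t * (n / t - t⁻¹)) / 2 + K * (n / t) * t⁻¹ := by
    intro K t n ht
    induction n with
    | zero => simp
    | succ n ih => rw [Finset.sum_range_succ, ih]; push_cast; field_simp; ring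
  have hlim : ∀ K : ℝ, Tendsto (fun p => Real.exp (-((N p : ℝ) / τ p * (N p / τ p - (τ p)⁻¹)) / 2
      + K * (N p / τ p) * (τ p)⁻¹)) l (𝓝 (Real.exp (-x ^ 2 / 2))) := by
    intro K
    refine (Real.continuous_exp.tendsto _).comp ?_
    have h := (((hN.mul (hN.sub hinv)).neg).div_const 2).add ((hN.const_mul K).mul hinv)
    convert! h using 2
    ring
  have hlt : ∀ᶠ p in l, (N p : ℝ) / τ p < x + 1 := hN.eventually_lt_const (by linarith)
  refine tendsto_of_tendsto_of_tendsto_of_le_of_le' (hlim (-C)) (hlim C) ?_ ?_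
  · filter_upwards [hC, hlt, hτ.eventually_gt_atTop 0] with p hp hlt h0
    rw [← hsum _ _ _ h0.ne', Real.exp_sum]
    refine Finset.prod_le_prod (fun i _ => (Real.exp_pos _).le) fun i hi => ?_
    have hi' : (i : ℝ) ≤ N p := by exact_mod_cast (Finset.mem_range.1 hi).le
    rw [div_lt_iff₀ h0] at hlt
    convert! (hp i (by linarith)).1 using 2
    ring
  · filter_upwards [hC, hlt, hτ.eventually_gt_atTop 0, r0] with p hp hlt h0 r0
    rw [← hsum _ _ _ h0.ne', Real.exp_sum]
    refine Finset.prod_le_prod (fun i _ => r0 i) fun i hi => ?_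
    have hi' : (i : ℝ) ≤ N p := by exact_mod_cast (Finset.mem_range.1 hi).le
    rw [div_lt_iff₀ h0] at hlt
    exact (hp i (by linarith)).2

lemma tendsto_pow_cexp (hτ : Tendsto τ l atTop) {v : ι → ℂ} {c : ℂ}
    (hv : Tendsto (fun p => τ p * (v p - 1)) l (𝓝 c))
    {N : ι → ℕ} {x : ℝ} (hN : Tendsto (fun p => (N p : ℝ) / τ p) l (𝓝 x)) :
    Tendsto (fun p => v p ^ N p) l (𝓝 (Complex.exp (c * x))) := by
  have hinv : Tendsto (fun p => ((τ p : ℂ))⁻¹) l (𝓝 0) := by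
    have := (Complex.continuous_ofReal.tendsto 0).comp hτ.inv_tendsto_atTop
    simpa [Function.comp_def] using this
  have hne : ∀ᶠ p in l, (τ p : ℂ) ≠ 0 := by
    filter_upwards [hτ.eventually_gt_atTop 0] with p hp
    exact_mod_cast hp.ne'
  have hu : Tendsto (fun p => v p - 1) l (𝓝 0) := by
    have h := hinv.mul hv
    rw [zero_mul] at h
    refine h.congr' ?_
    filter_upwards [hne] with p hp
    field_simp
  have hv1 : Tendsto v l (𝓝 1) := by simpa using hu.add_const 1
  have hlog : Tendsto (fun p => τ p * Complex.log (v p)) l (𝓝 c) := by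
    have hd := (Complex.hasDerivAt_log (z := 1) (by simp)).isLittleO.comp_tendsto hv1
    have h2 : (fun p => (τ p : ℂ) * (Complex.log (v p) - (v p - 1))) =o[l]
        fun p => (τ p : ℂ) * (v p - 1) := by
      refine (Asymptotics.isBigO_refl (fun p => (τ p : ℂ)) l).mul_isLittleO ?_
      simpa [Function.comp_def] using hd
    have h3 := (Asymptotics.isLittleO_one_iff ℂ).1 (h2.trans_isBigO (hv.isBigO_one ℂ))
    convert! h3.add hv using 2
    · ring
    · simp
  have hN' : Tendsto (fun p => ((N p : ℂ) / τ p)) l (𝓝 x) := by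
    have := (Complex.continuous_ofReal.tendsto x).comp hN
    simpa [Function.comp_def] using this
  have h := (Complex.continuous_exp.tendsto _).comp (hlog.mul hN')
  refine h.congr' ?_
  filter_upwards [hne, hv1.eventually_ne one_ne_zero] with p hp hv0
  simp only [Function.comp_apply]
  rw [show (τ p : ℂ) * Complex.log (v p) * (N p / τ p) = N p * Complex.log (v p) by field_simp,
    Complex.exp_nat_mul, Complex.exp_log hv0]

lemma eventually_norm_prod_mul_pow_le (hτ : Tendsto τ l atTop) (r0 : ∀ᶠ p in l, ∀ i, 0 ≤ r p i)
    (r1 : ∀ᶠ p in l, ∀ i, r p i ≤ 1) (ha : ∀ᶠ p in l, Antitone (r p))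
    (hr : ∀ X : ℝ, ∃ C : ℝ, ∀ᶠ p in l, ∀ i : ℕ, (i : ℝ) ≤ X * τ p →
      Real.exp (-(i / τ p ^ 2) - C / τ p ^ 2) ≤ r p i ∧
        r p i ≤ Real.exp (-(i / τ p ^ 2) + C / τ p ^ 2))
    {v : ι → ℂ} {c : ℂ} (hv : Tendsto (fun p => τ p * (v p - 1)) l (𝓝 c)) :
    ∃ D : ℝ, ∀ᶠ p in l, ∀ j : ℕ,
      ‖((∏ i ∈ Finset.range j, r p i : ℝ) : ℂ) * v p ^ j‖ ≤ D * Real.exp (-(j / τ p)) := by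
  set M := ‖c‖ + 1 with hM
  have hM0 : 0 < M := by positivity
  obtain ⟨C, hC⟩ := hr (M + 3)
  have hCτ : ∀ᶠ p in l, C / τ p ≤ 1 := by
    have : Tendsto (fun p => C / τ p) l (𝓝 0) := hτ.const_div_atTop C
    exact this.eventually_le_const one_pos
  refine ⟨Real.exp ((M + 1) * (M + 3)), ?_⟩
  filter_upwards [r0, r1, ha, hC, hCτ, hτ.eventually_ge_atTop 1,
    hv.norm.eventually_lt_const (show ‖c‖ < M by linarith)] with p r0 r1 ha hC hCτ h1 hvM j
  have h0 : 0 < τ p := by linarith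
  obtain ⟨J, hJ1, hJ2⟩ : ∃ J : ℕ, (M + 2) * τ p ≤ J ∧ (J : ℝ) ≤ (M + 3) * τ p :=
    ⟨⌈(M + 2) * τ p⌉₊, Nat.le_ceil _, by
      have := Nat.ceil_lt_add_one (show 0 ≤ (M + 2) * τ p by positivity)
      nlinarith⟩
  have hrJ : r p J ≤ Real.exp (-((M + 1) / τ p)) := by
    refine (hC J hJ2).2.trans (Real.exp_le_exp.2 ?_)
    have e1 : (M + 2) / τ p ≤ J / τ p ^ 2 := by
      rw [div_le_div_iff₀ h0 (by positivity)]
      nlinarith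
    have e2 : C / τ p ^ 2 ≤ 1 / τ p := by
      rw [sq, ← div_div]
      gcongr
    have e3 : (M + 2) / τ p = (M + 1) / τ p + 1 / τ p := by ring
    linarith
  have hprod : ∀ j : ℕ, ∏ i ∈ Finset.range j, r p i ≤ Real.exp ((M + 1) / τ p * (J - j)) := by
    intro j
    induction j with
    | zero => simpa using by positivity
    | succ j ih =>
      rcases lt_or_ge j J with hj | hj
      · refine (Finset.prod_le_one (fun i _ => r0 i) fun i _ => r1 i).trans ?_
        have : ((j + 1 : ℕ) : ℝ) ≤ J := by exact_mod_cast hj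
        exact Real.one_le_exp (mul_nonneg (by positivity) (by linarith))
      · rw [Finset.prod_range_succ]
        refine (mul_le_mul ih ((ha hj).trans hrJ) (r0 j) (Real.exp_pos _).le).trans ?_
        rw [← Real.exp_add]
        refine (Real.exp_le_exp.2 (le_of_eq ?_))
        push_cast
        ring
  have hvn : ‖v p‖ ≤ Real.exp (M / τ p) := by
    have h2 : ‖v p‖ ≤ ‖v p - 1‖ + 1 := by
      simpa using norm_add_le (v p - 1) 1
    rw [norm_mul, Complex.norm_real, Real.norm_of_nonneg h0.le] at hvM
    have h3 : ‖v p - 1‖ ≤ M / τ p := by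
      rw [le_div_iff₀ h0]; linarith
    linarith [Real.add_one_le_exp (M / τ p)]
  have hp0 : 0 ≤ ∏ i ∈ Finset.range j, r p i := Finset.prod_nonneg fun i _ => r0 i
  rw [norm_mul, Complex.norm_real, Real.norm_of_nonneg hp0, norm_pow]
  calc _ ≤ Real.exp ((M + 1) / τ p * (J - j)) * Real.exp (M / τ p) ^ j := by
        gcongr
        exact hprod j
    _ = Real.exp ((M + 1) * (J / τ p)) * Real.exp (-(j / τ p)) := by
        rw [← Real.exp_nat_mul, ← Real.exp_add, ← Real.exp_add]
        congr 1
        ring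
    _ ≤ _ := by
        gcongr
        rwa [div_le_iff₀ h0]

lemma tendsto_sum_prod_mul_pow [l.IsCountablyGenerated]
    (hτ : Tendsto τ l atTop) (r0 : ∀ᶠ p in l, ∀ i, 0 ≤ r p i)
    (r1 : ∀ᶠ p in l, ∀ i, r p i ≤ 1) (ha : ∀ᶠ p in l, Antitone (r p))
    (hr : ∀ X : ℝ, ∃ C : ℝ, ∀ᶠ p in l, ∀ i : ℕ, (i : ℝ) ≤ X * τ p →
      Real.exp (-(i / τ p ^ 2) - C / τ p ^ 2) ≤ r p i ∧
        r p i ≤ Real.exp (-(i / τ p ^ 2) + C / τ p ^ 2))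
    {v : ι → ℂ} {c : ℂ} (hv : Tendsto (fun p => τ p * (v p - 1)) l (𝓝 c)) :
    (∀ᶠ p in l, Summable fun j : ℕ => ((∏ i ∈ Finset.range j, r p i : ℝ) : ℂ) * v p ^ j) ∧
    Tendsto (fun p => (τ p : ℂ)⁻¹ * ∑' j : ℕ, ((∏ i ∈ Finset.range j, r p i : ℝ) : ℂ) * v p ^ j) l
      (𝓝 (∫ x in Set.Ioi (0 : ℝ), Complex.exp (-(x : ℂ) ^ 2 / 2 + c * x))) := by
  obtain ⟨D, hD⟩ := eventually_norm_prod_mul_pow_le hτ r0 r1 ha hr hv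
  set g : ι → ℕ → ℂ := fun p j => ((∏ i ∈ Finset.range j, r p i : ℝ) : ℂ) * v p ^ j with hg
  have hmeas : ∀ p, AEStronglyMeasurable (fun x : ℝ => g p ⌊τ p * x⌋₊)
      (volume.restrict (Set.Ioi 0)) := fun p =>
    ((measurable_from_nat (f := g p)).comp
      (Nat.measurable_floor.comp (measurable_const_mul _))).aestronglyMeasurable
  have hint : Integrable (fun x : ℝ => |D| * Real.exp 1 * Real.exp (-x))
      (volume.restrict (Set.Ioi 0)) :=
    (integrableOn_exp_neg_Ioi 0).const_mul _
  have hbound : ∀ᶠ p in l, ∀ᵐ x : ℝ ∂volume.restrict (Set.Ioi 0),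
      ‖g p ⌊τ p * x⌋₊‖ ≤ |D| * Real.exp 1 * Real.exp (-x) := by
    filter_upwards [hD, hτ.eventually_ge_atTop 1] with p hp h1
    filter_upwards [ae_restrict_mem measurableSet_Ioi] with x hx
    have h0 : 0 < τ p := by linarith
    refine (hp _).trans ?_
    rw [mul_assoc, ← Real.exp_add]
    gcongr
    · exact le_abs_self D
    · have h2 := Nat.lt_floor_add_one (τ p * x)
      have h3 : x - 1 ≤ (⌊τ p * x⌋₊ : ℝ) / τ p := by
        rw [le_div_iff₀ h0]
        nlinarith
      linarith
  have hsum : ∀ᶠ p in l, HasSum (g p) (τ p * ∫ x in Set.Ioi (0 : ℝ), g p ⌊τ p * x⌋₊) := by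
    filter_upwards [hbound, hτ.eventually_gt_atTop 0] with p hp h0
    exact hasSum_integral_floor_mul h0 (hint.mono' (hmeas p) hp)
  refine ⟨hsum.mono fun p hp => hp.summable, ?_⟩
  have hlim := tendsto_integral_filter_of_dominated_convergence
    (fun x : ℝ => |D| * Real.exp 1 * Real.exp (-x)) (Eventually.of_forall hmeas) hbound hint
    (f := fun x : ℝ => Complex.exp (-(x : ℂ) ^ 2 / 2 + c * x)) (by
      filter_upwards [ae_restrict_mem measurableSet_Ioi] with x hx
      have hN : Tendsto (fun p => (⌊τ p * x⌋₊ : ℝ) / τ p) l (𝓝 x) := by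
        have := (tendsto_nat_floor_mul_div_atTop (R := ℝ) (le_of_lt hx)).comp hτ
        simpa [Function.comp_def, mul_comm] using this
      have h1 := (Complex.continuous_ofReal.tendsto _).comp (tendsto_prod_range_gaussian hτ r0 hr hN)
      have h2 := h1.mul (tendsto_pow_cexp hτ hv hN)
      convert! h2 using 2
      rw [Complex.exp_add]
      push_cast
      rfl)
  refine hlim.congr' ?_
  filter_upwards [hsum, hτ.eventually_gt_atTop 0] with p hp h0
  have : (τ p : ℂ) ≠ 0 := by exact_mod_cast h0.ne'
  rw [hp.tsum_eq]
  field_simp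

end LaplaceSum

/-- The Gaussian integral over a half-line, with an exponential tilt. -/
noncomputable def halfGauss (c : ℂ) : ℂ :=
  ∫ x in Set.Ioi (0 : ℝ), Complex.exp (-(x : ℂ) ^ 2 / 2 + c * x)

lemma integrable_cexp_tilt (c : ℂ) :
    Integrable fun x : ℝ => Complex.exp (-(x : ℂ) ^ 2 / 2 + c * x) := by
  have h := integrable_cexp_quadratic (b := 1 / 2) (by norm_num) c 0
  convert! h using 3
  ring

lemma norm_cexp_tilt (c : ℂ) (x : ℝ) :
    ‖Complex.exp (-(x : ℂ) ^ 2 / 2 + c * x)‖ = Real.exp (-x ^ 2 / 2 + c.re * x) := by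
  rw [Complex.norm_exp]
  congr 1
  have : -(x : ℂ) ^ 2 / 2 = ((-x ^ 2 / 2 : ℝ) : ℂ) := by push_cast; ring
  rw [this, Complex.add_re, Complex.ofReal_re, Complex.re_mul_ofReal]

lemma integrable_rexp_tilt (b : ℝ) :
    Integrable fun x : ℝ => Real.exp (-x ^ 2 / 2 + b * x) := by
  have h := (integrable_cexp_tilt b).norm
  simp_rw [norm_cexp_tilt] at h
  simpa using h

lemma integrableOn_mul_cexp_tilt (c : ℂ) :
    IntegrableOn (fun x : ℝ => (x : ℂ) * Complex.exp (-(x : ℂ) ^ 2 / 2 + c * x)) (Set.Ioi 0) := by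
  refine (integrable_rexp_tilt (c.re + 1)).integrableOn.mono'
    (Continuous.aestronglyMeasurable (by fun_prop)) ?_
  filter_upwards [ae_restrict_mem measurableSet_Ioi] with x hx
  have hx : 0 < x := hx
  rw [norm_mul, norm_cexp_tilt, Complex.norm_real, Real.norm_of_nonneg hx.le]
  calc _ ≤ Real.exp x * Real.exp (-x ^ 2 / 2 + c.re * x) := by
        gcongr
        linarith [Real.add_one_le_exp x]
    _ = _ := by rw [← Real.exp_add]; ring_nf

lemma integral_mul_cexp_tilt (c : ℂ) :
    ∫ x in Set.Ioi (0 : ℝ), (x : ℂ) * Complex.exp (-(x : ℂ) ^ 2 / 2 + c * x)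
      = 1 + c * halfGauss c := by
  have hd : ∀ x ∈ Set.Ici (0 : ℝ), HasDerivAt
      (fun x : ℝ => Complex.exp (-(x : ℂ) ^ 2 / 2 + c * x))
      (c * Complex.exp (-(x : ℂ) ^ 2 / 2 + c * x)
        - x * Complex.exp (-(x : ℂ) ^ 2 / 2 + c * x)) x := by
    intro x _
    have h1 : HasDerivAt (fun z : ℂ => Complex.exp (-z ^ 2 / 2 + c * z))
        (Complex.exp (-(x : ℂ) ^ 2 / 2 + c * x) * (-(2 * x) / 2 + c)) (x : ℂ) := by
      have := ((((hasDerivAt_id (x : ℂ)).pow 2).neg.div_const 2).add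
        ((hasDerivAt_id (x : ℂ)).const_mul c)).cexp
      convert! this using 1
      simp
    convert! h1.comp_ofReal using 1
    ring
  have hi1 : IntegrableOn (fun x : ℝ => c * Complex.exp (-(x : ℂ) ^ 2 / 2 + c * x))
    (Set.Ioi 0) := ((integrable_cexp_tilt c).const_mul c).integrableOn
  have hi2 := integrableOn_mul_cexp_tilt c
  have hlim : Tendsto (fun x : ℝ => Complex.exp (-(x : ℂ) ^ 2 / 2 + c * x)) atTop (𝓝 0) := by
    rw [tendsto_zero_iff_norm_tendsto_zero]
    simp_rw [norm_cexp_tilt]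
    refine Real.tendsto_exp_atBot.comp ?_
    have h1 : Tendsto (fun x : ℝ => x * (-x / 2 + c.re)) atTop atBot := by
      refine tendsto_id.atTop_mul_atBot₀ ?_
      refine tendsto_atBot_add_const_right _ _ ?_
      exact (tendsto_neg_atTop_atBot).atBot_div_const (by norm_num)
    refine h1.congr fun x => by ring
  have h := integral_Ioi_of_hasDerivAt_of_tendsto' hd (hi1.sub hi2) hlim
  rw [integral_sub hi1 hi2, integral_const_mul] at h
  simp only [Complex.ofReal_zero, mul_zero, add_zero] at h
  norm_num at h
  rw [halfGauss]
  linear_combination -h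

lemma hasDerivAt_halfGauss (c : ℂ) : HasDerivAt halfGauss (1 + c * halfGauss c) c := by
  rw [← integral_mul_cexp_tilt]
  refine (hasDerivAt_integral_of_dominated_loc_of_deriv_le
    (F := fun (c : ℂ) (x : ℝ) => Complex.exp (-(x : ℂ) ^ 2 / 2 + c * x))
    (F' := fun (c : ℂ) (x : ℝ) => (x : ℂ) * Complex.exp (-(x : ℂ) ^ 2 / 2 + c * x))
    (bound := fun x => Real.exp (-x ^ 2 / 2 + (c.re + 2) * x))
    (Metric.ball_mem_nhds c one_pos) ?_ ?_ ?_ ?_ ?_ ?_).2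
  · exact Eventually.of_forall fun c => (integrable_cexp_tilt c).integrableOn.aestronglyMeasurable
  · exact (integrable_cexp_tilt c).integrableOn
  · exact (integrableOn_mul_cexp_tilt c).aestronglyMeasurable
  · filter_upwards [ae_restrict_mem measurableSet_Ioi] with x hx z hz
    have hx : 0 < x := hx
    have hre : z.re ≤ c.re + 1 := by
      have h := (Complex.abs_re_le_norm (z - c)).trans (mem_ball_iff_norm.1 hz).le
      have := (abs_le.1 h).2
      simp at this
      linarith
    rw [norm_mul, norm_cexp_tilt, Complex.norm_real, Real.norm_of_nonneg hx.le]
    calc _ ≤ Real.exp x * Real.exp (-x ^ 2 / 2 + (c.re + 1) * x) := by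
          gcongr
          linarith [Real.add_one_le_exp x]
      _ = _ := by rw [← Real.exp_add]; ring_nf
  · exact (integrable_rexp_tilt _).integrableOn
  · refine Eventually.of_forall fun x z _ => ?_
    have := (((hasDerivAt_id z).mul_const (x : ℂ)).const_add (-(x : ℂ) ^ 2 / 2)).cexp
    convert! this using 1
    simp [mul_comm]

lemma halfGauss_zero : halfGauss 0 = (Real.sqrt (π / 2) : ℂ) := by
  have h := integral_gaussian_Ioi (1 / 2)
  have h2 : halfGauss 0 = ((∫ x in Set.Ioi (0 : ℝ), Real.exp (-(1 / 2) * x ^ 2) : ℝ) : ℂ) := by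
    rw [halfGauss, ← integral_complex_ofReal]
    congr 1
    funext x
    push_cast
    ring_nf
  rw [h2, h]
  congr 1
  rw [show π / (1 / 2) = (π / 2) * 2 ^ 2 by ring, Real.sqrt_mul (by positivity),
    Real.sqrt_sq (by norm_num)]
  ring

lemma halfGauss_eq_erfc (ζ : ℂ) :
    halfGauss (-(Real.sqrt 2 : ℂ) * ζ)
      = (Real.sqrt (π / 2) : ℂ) * (Complex.exp (ζ ^ 2) * erfc ζ) := by
  have hs : (Real.sqrt 2 : ℂ) ^ 2 = 2 := by
    rw [← Complex.ofReal_pow, Real.sq_sqrt (by norm_num)]; norm_num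
  set q : ℂ := -(Real.sqrt 2 : ℂ) * ζ with hq
  have hq2 : q ^ 2 = 2 * ζ ^ 2 := by rw [hq]; linear_combination ζ ^ 2 * hs
  have hd : ∀ t ∈ Set.uIcc (0 : ℝ) 1, HasDerivAt
      (fun t : ℝ => Complex.exp (-((t : ℂ) * ζ) ^ 2) * halfGauss (t * q))
      (-(Real.sqrt 2 : ℂ) * (ζ * Complex.exp (-((t : ℂ) * ζ) ^ 2))) t := by
    intro t _
    have h1 : HasDerivAt (fun z : ℂ => Complex.exp (-(z * ζ) ^ 2))
        (Complex.exp (-((t : ℂ) * ζ) ^ 2) * (-(2 * (t * ζ) * ζ))) (t : ℂ) := by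
      have := ((((hasDerivAt_id (t : ℂ)).mul_const ζ).pow 2).neg).cexp
      convert! this using 1
      simp
    have h2 : HasDerivAt (fun z : ℂ => halfGauss (z * q))
        ((1 + t * q * halfGauss (t * q)) * q) (t : ℂ) := by
      have := (hasDerivAt_halfGauss (t * q)).comp (t : ℂ) ((hasDerivAt_id (t : ℂ)).mul_const q)
      simpa [Function.comp_def] using this
    convert! (h1.mul h2).comp_ofReal using 1
    have : q * Complex.exp (-((t : ℂ) * ζ) ^ 2) =
      -(Real.sqrt 2 : ℂ) * (ζ * Complex.exp (-((t : ℂ) * ζ) ^ 2)) := by rw [hq]; ring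
    linear_combination -this - t * halfGauss (t * q) * Complex.exp (-((t : ℂ) * ζ) ^ 2) * hq2
  have h := intervalIntegral.integral_eq_sub_of_hasDerivAt hd
    (Continuous.intervalIntegrable (by fun_prop) _ _)
  rw [intervalIntegral.integral_const_mul] at h
  simp only [Complex.ofReal_one, one_mul, Complex.ofReal_zero, zero_mul, halfGauss_zero] at h
  have hexp : Complex.exp (ζ ^ 2) * Complex.exp (-ζ ^ 2) = 1 := by
    rw [← Complex.exp_add]; simp
  have hc : (Real.sqrt (π / 2) : ℂ) * ((2 / Real.sqrt π : ℝ) : ℂ) = (Real.sqrt 2 : ℂ) := by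
    rw [← Complex.ofReal_mul]
    congr 1
    rw [Real.sqrt_div pi_pos.le]
    have h2 : Real.sqrt 2 ^ 2 = 2 := Real.sq_sqrt (by norm_num)
    have : 0 < Real.sqrt π := Real.sqrt_pos.2 pi_pos
    field_simp
    linarith
  rw [erfc]
  set I := ∫ t in (0 : ℝ)..1, ζ * Complex.exp (-((t : ℂ) * ζ) ^ 2)
  have h0 : Complex.exp (-(0 : ℂ) ^ 2) = 1 := by simp
  linear_combination -(Complex.exp (ζ ^ 2)) * h - halfGauss q * hexp
    + Complex.exp (ζ ^ 2) * I * hc + Complex.exp (ζ ^ 2) * (Real.sqrt (π / 2) : ℂ) * h0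

lemma erfc_neg (ζ : ℂ) : erfc (-ζ) = 2 - erfc ζ := by
  simp only [erfc, mul_neg, neg_mul, neg_sq, intervalIntegral.integral_neg]
  ring

/-- Ratios of consecutive terms of the series at `Rn ρ n`, to the right of index `n`. -/
noncomputable def ratioRight (ρ : ℝ) (n i : ℕ) : ℝ := Rn ρ n / Rn ρ (n + i + 1)

/-- Ratios of consecutive terms of the series at `Rn ρ n`, to the left of index `n`. -/
noncomputable def ratioLeft (ρ : ℝ) (n i : ℕ) : ℝ := if i < n then Rn ρ (n - i) / Rn ρ n else 0

lemma ratioRight_nonneg {ρ : ℝ} (hρ : 1 < ρ) (n i : ℕ) : 0 ≤ ratioRight ρ n i :=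
  (div_pos (Rn_pos hρ _) (Rn_pos hρ _)).le

lemma ratioRight_le_one {ρ : ℝ} (hρ : 1 < ρ) (n i : ℕ) : ratioRight ρ n i ≤ 1 :=
  (div_le_one (Rn_pos hρ _)).2 (Rn_mono hρ (by omega))

lemma ratioRight_antitone {ρ : ℝ} (hρ : 1 < ρ) (n : ℕ) : Antitone (ratioRight ρ n) :=
  fun _ _ h => div_le_div_of_nonneg_left (Rn_pos hρ _).le (Rn_pos hρ _) (Rn_mono hρ (by omega))

lemma ratioLeft_nonneg {ρ : ℝ} (hρ : 1 < ρ) (n i : ℕ) : 0 ≤ ratioLeft ρ n i := by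
  unfold ratioLeft
  split_ifs
  · exact (div_pos (Rn_pos hρ _) (Rn_pos hρ _)).le
  · exact le_rfl

lemma ratioLeft_le_one {ρ : ℝ} (hρ : 1 < ρ) (n i : ℕ) : ratioLeft ρ n i ≤ 1 := by
  unfold ratioLeft
  split_ifs
  · exact (div_le_one (Rn_pos hρ _)).2 (Rn_mono hρ (by omega))
  · exact zero_le_one

lemma ratioLeft_antitone {ρ : ℝ} (hρ : 1 < ρ) (n : ℕ) : Antitone (ratioLeft ρ n) := by
  intro i j hij
  by_cases hj : j < n
  · rw [ratioLeft, ratioLeft, if_pos hj, if_pos (by omega)]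
    exact div_le_div_of_nonneg_right (Rn_mono hρ (by omega)) (Rn_pos hρ _).le
  · rw [ratioLeft, if_neg hj]
    exact ratioLeft_nonneg hρ n i

lemma tendsto_sqrt_mul_natCast {ρ : ℝ} (hρ : 0 < ρ) :
    Tendsto (fun n : ℕ => Real.sqrt (ρ * n)) atTop atTop :=
  Real.tendsto_sqrt_atTop.comp (tendsto_natCast_atTop_atTop.const_mul_atTop hρ)

lemma ratioRight_bounds {ρ : ℝ} (hρ : 1 < ρ) (X : ℝ) :
    ∃ C : ℝ, ∀ᶠ n : ℕ in atTop, ∀ i : ℕ, (i : ℝ) ≤ X * Real.sqrt (ρ * n) →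
      Real.exp (-(i / Real.sqrt (ρ * n) ^ 2) - C / Real.sqrt (ρ * n) ^ 2) ≤ ratioRight ρ n i ∧
        ratioRight ρ n i ≤
          Real.exp (-(i / Real.sqrt (ρ * n) ^ 2) + C / Real.sqrt (ρ * n) ^ 2) := by
  have hρ0 : 0 < ρ := by linarith
  refine ⟨1 + ρ ^ 2 + (|X| + 2) ^ 2 * ρ ^ 2, ?_⟩
  filter_upwards [(tendsto_sqrt_mul_natCast hρ0).eventually_ge_atTop 1, eventually_ge_atTop 1]
    with n h1 hn i hi
  set τ := Real.sqrt (ρ * n) with hτ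
  have hn0 : (0 : ℝ) < n := by exact_mod_cast hn
  have hτ2 : τ ^ 2 = ρ * n := Real.sq_sqrt (by positivity)
  have hiX : (i : ℝ) ≤ |X| * τ := hi.trans (by gcongr; exact le_abs_self X)
  have hi0 : (0 : ℝ) ≤ i := by positivity
  have hb := log_Rn_sub_bounds hρ hn (i + 1)
  rw [← add_assoc] at hb
  push_cast at hb
  have hr : ratioRight ρ n i
      = Real.exp (-(Real.log (Rn ρ (n + i + 1)) - Real.log (Rn ρ n))) := by
    rw [neg_sub, Real.exp_sub, Real.exp_log (Rn_pos hρ _), Real.exp_log (Rn_pos hρ _), ratioRight]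
  have hq : ((i : ℝ) + 1) / (n : ℝ) ^ 2 * (i + 1 + 1) ≤ (|X| + 2) ^ 2 * ρ / n := by
    have h3 : ((i : ℝ) + 1) * (i + 1 + 1) ≤ (|X| + 2) ^ 2 * (ρ * n) := by
      rw [← hτ2, ← mul_pow, sq]
      gcongr <;> nlinarith
    rw [div_mul_eq_mul_div, div_le_div_iff₀ (by positivity) hn0]
    nlinarith
  have e1 : ((i : ℝ) + 1) / (ρ * n) = i / (ρ * n) + 1 / (ρ * n) := by ring
  have e2 : (1 + ρ ^ 2 + (|X| + 2) ^ 2 * ρ ^ 2) / (ρ * n)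
      = 1 / (ρ * n) + ρ / n + (|X| + 2) ^ 2 * ρ / n := by field_simp
  have e3 : 0 ≤ 1 / (ρ * n) := by positivity
  have e4 : 0 ≤ (|X| + 2) ^ 2 * ρ / n := by positivity
  rw [hr, hτ2, e2]
  constructor <;> apply Real.exp_le_exp.2 <;> linarith [hb.1, hb.2]

lemma ratioLeft_bounds {ρ : ℝ} (hρ : 1 < ρ) (X : ℝ) :
    ∃ C : ℝ, ∀ᶠ n : ℕ in atTop, ∀ i : ℕ, (i : ℝ) ≤ X * Real.sqrt (ρ * n) →
      Real.exp (-(i / Real.sqrt (ρ * n) ^ 2) - C / Real.sqrt (ρ * n) ^ 2) ≤ ratioLeft ρ n i ∧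
        ratioLeft ρ n i ≤
          Real.exp (-(i / Real.sqrt (ρ * n) ^ 2) + C / Real.sqrt (ρ * n) ^ 2) := by
  have hρ0 : 0 < ρ := by linarith
  refine ⟨2 * |X| ^ 2 * ρ + 2 * ρ ^ 2 + 4 * (|X| + 2) ^ 2 * ρ ^ 2, ?_⟩
  filter_upwards [(tendsto_sqrt_mul_natCast hρ0).eventually_ge_atTop (1 + 2 * ρ * |X|),
    eventually_ge_atTop 1] with n hlarge hn i hi
  set τ := Real.sqrt (ρ * n) with hτ
  have h1 : 1 ≤ τ := le_trans (by linarith [show 0 ≤ 2 * ρ * |X| by positivity]) hlarge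
  have hn0 : (0 : ℝ) < n := by exact_mod_cast hn
  have hτ2 : τ ^ 2 = ρ * n := Real.sq_sqrt (by positivity)
  have hiX : (i : ℝ) ≤ |X| * τ := hi.trans (by gcongr; exact le_abs_self X)
  have hi0 : (0 : ℝ) ≤ i := by positivity
  have hin : (i : ℝ) ≤ n / 2 := by
    have h2 : 2 * ρ * |X| * τ ≤ τ * τ := by gcongr; linarith
    have h3 : ρ * (2 * i) ≤ ρ * n := by
      rw [← hτ2]
      nlinarith
    linarith [le_of_mul_le_mul_left h3 hρ0]
  have hilt : i < n := by
    have : (i : ℝ) < n := by linarith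
    exact_mod_cast this
  have hb := log_Rn_sub_bounds hρ (show 1 ≤ n - i by omega) i
  rw [Nat.sub_add_cancel hilt.le, Nat.cast_sub hilt.le] at hb
  have hr : ratioLeft ρ n i = Real.exp (-(Real.log (Rn ρ n) - Real.log (Rn ρ (n - i)))) := by
    rw [neg_sub, Real.exp_sub, Real.exp_log (Rn_pos hρ _), Real.exp_log (Rn_pos hρ _), ratioLeft,
      if_pos hilt]
  set k : ℝ := n - i with hk
  have hkn : n / 2 ≤ k := by linarith
  have hk0 : 0 < k := by linarith
  have hq : (i : ℝ) / k ^ 2 * (i + 1) ≤ 4 * (|X| + 2) ^ 2 * ρ / n := by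
    have h3 : (i : ℝ) * (i + 1) ≤ (|X| + 2) ^ 2 * (ρ * n) := by
      rw [← hτ2, ← mul_pow, sq]
      gcongr <;> nlinarith
    calc (i : ℝ) / k ^ 2 * (i + 1) = (i : ℝ) * (i + 1) / k ^ 2 := by ring
      _ ≤ (|X| + 2) ^ 2 * (ρ * n) / (n / 2) ^ 2 := by gcongr
      _ = _ := by field_simp; ring
  have hinv : ρ / k ≤ 2 * ρ / n := by
    calc ρ / k ≤ ρ / (n / 2) := by gcongr
      _ = _ := by field_simp
  have hlow : i / (ρ * n) ≤ i / (ρ * k) := by gcongr; linarith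
  have hup : i / (ρ * k) ≤ i / (ρ * n) + 2 * |X| ^ 2 / n := by
    have h3 : (i : ℝ) ^ 2 ≤ |X| ^ 2 * (ρ * n) := by
      rw [← hτ2, ← mul_pow]
      gcongr
    have h4 : i / (ρ * k) = i / (ρ * n) + i ^ 2 / (ρ * k * n) := by
      rw [hk] at hk0 ⊢
      field_simp
      ring
    have h5 : (i : ℝ) ^ 2 / (ρ * k * n) ≤ 2 * |X| ^ 2 / n := by
      calc (i : ℝ) ^ 2 / (ρ * k * n) ≤ |X| ^ 2 * (ρ * n) / (ρ * (n / 2) * n) := by gcongr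
        _ = _ := by field_simp
    linarith
  have e2 : (2 * |X| ^ 2 * ρ + 2 * ρ ^ 2 + 4 * (|X| + 2) ^ 2 * ρ ^ 2) / (ρ * n)
      = 2 * |X| ^ 2 / n + 2 * ρ / n + 4 * (|X| + 2) ^ 2 * ρ / n := by field_simp
  have e3 : 0 ≤ 2 * |X| ^ 2 / n := by positivity
  have e4 : 0 ≤ 4 * (|X| + 2) ^ 2 * ρ / n := by positivity
  rw [hr, hτ2, e2]
  constructor <;> apply Real.exp_le_exp.2 <;> linarith [hb.1, hb.2]

lemma prod_ratioRight {ρ : ℝ} (hρ : 1 < ρ) (n j : ℕ) :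
    ∏ i ∈ Finset.range j, ratioRight ρ n i =
      Rn ρ n ^ j * Real.Gamma (1 + (n : ℝ) / ρ) / Real.Gamma (1 + ((n + j : ℕ) : ℝ) / ρ) := by
  induction j with
  | zero => simp [(Gamma_coeff_pos hρ n).ne']
  | succ j ih =>
    have h1 := (Gamma_coeff_pos hρ (n + j)).ne'
    have h2 := (Gamma_coeff_pos hρ (n + j + 1)).ne'
    rw [Finset.prod_range_succ, ih, ratioRight, Rn_succ, ← add_assoc]
    field_simp
    ring

lemma prod_ratioLeft {ρ : ℝ} (hρ : 1 < ρ) {n j : ℕ} (hj : j ≤ n) :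
    ∏ i ∈ Finset.range j, ratioLeft ρ n i =
      Real.Gamma (1 + (n : ℝ) / ρ) / (Rn ρ n ^ j * Real.Gamma (1 + ((n - j : ℕ) : ℝ) / ρ)) := by
  induction j with
  | zero => simp [(Gamma_coeff_pos hρ n).ne']
  | succ j ih =>
    have h1 := (Gamma_coeff_pos hρ (n - (j + 1))).ne'
    have h2 := (Gamma_coeff_pos hρ (n - (j + 1) + 1)).ne'
    have h3 := (Rn_pos hρ n).ne'
    rw [Finset.prod_range_succ, ih (by omega), ratioLeft, if_pos (by omega),
      show n - j = n - (j + 1) + 1 by omega, Rn_succ]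
    field_simp
    ring

lemma prod_ratioLeft_eq_zero (ρ : ℝ) {n j : ℕ} (hj : n < j) :
    ∏ i ∈ Finset.range j, ratioLeft ρ n i = 0 :=
  Finset.prod_eq_zero (Finset.mem_range.2 hj) (by simp [ratioLeft])

/-- The term of index `n` of the series at `Rn ρ n`. -/
noncomputable def peakTerm (ρ : ℝ) (n : ℕ) : ℂ :=
  (Rn ρ n : ℂ) ^ n / (Real.Gamma (1 + (n : ℝ) / ρ) : ℂ)

lemma peakTerm_ne_zero {ρ : ℝ} (hρ : 1 < ρ) (n : ℕ) : peakTerm ρ n ≠ 0 := by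
  have h1 := (Rn_pos hρ n).ne'
  have h2 := (Gamma_coeff_pos hρ n).ne'
  exact div_ne_zero (pow_ne_zero _ (by exact_mod_cast h1)) (by exact_mod_cast h2)

/-- The terms of index at most `n`, normalised by the peak term. -/
noncomputable def sumLeft (ρ : ℝ) (n : ℕ) (v : ℂ) : ℂ :=
  ∑' j : ℕ, ((∏ i ∈ Finset.range j, ratioLeft ρ n i : ℝ) : ℂ) * v ^ j

/-- The terms of index at least `n`, normalised by the peak term. -/
noncomputable def sumRight (ρ : ℝ) (n : ℕ) (v : ℂ) : ℂ :=
  ∑' j : ℕ, ((∏ i ∈ Finset.range j, ratioRight ρ n i : ℝ) : ℂ) * v ^ j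

lemma mlSec_eq {ρ : ℝ} (hρ : 1 < ρ) (n : ℕ) {w : ℂ} (hw : w ≠ 0) :
    mlSec ρ n (Rn ρ n * w) = peakTerm ρ n * w ^ n * sumLeft ρ n w⁻¹ := by
  have hR : (Rn ρ n : ℂ) ≠ 0 := by exact_mod_cast (Rn_pos hρ n).ne'
  have hG : ∀ k : ℕ, (Real.Gamma (1 + (k : ℝ) / ρ) : ℂ) ≠ 0 := fun k => by
    exact_mod_cast (Gamma_coeff_pos hρ k).ne'
  rw [sumLeft, tsum_eq_sum (s := Finset.range (n + 1)) fun j hj => by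
    rw [prod_ratioLeft_eq_zero ρ (by simpa using hj)]; simp, mlSec,
    ← Finset.sum_range_reflect, Finset.mul_sum]
  refine Finset.sum_congr rfl fun j hj => ?_
  have hj : j ≤ n := by simpa [Nat.lt_succ_iff] using hj
  rw [prod_ratioLeft hρ hj, show n + 1 - 1 - j = n - j by omega, peakTerm]
  have h1 := hG n
  have h2 := hG (n - j)
  have e1 : ((Rn ρ n : ℂ) * w) ^ n = ((Rn ρ n : ℂ) * w) ^ (n - j) * ((Rn ρ n : ℂ) * w) ^ j := by
    rw [← pow_add, Nat.sub_add_cancel hj]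
  rw [mul_pow] at e1
  rw [Complex.ofReal_div, Complex.ofReal_mul, Complex.ofReal_pow, inv_pow]
  generalize (Real.Gamma (1 + (n : ℝ) / ρ) : ℂ) = a at h1 ⊢
  generalize (Real.Gamma (1 + ((n - j : ℕ) : ℝ) / ρ) : ℂ) = b at h2 ⊢
  field_simp
  rw [e1]
  ring

lemma term_add_eq {ρ : ℝ} (hρ : 1 < ρ) (n j : ℕ) (w : ℂ) :
    (Rn ρ n * w) ^ (n + j) / (Real.Gamma (1 + ((n + j : ℕ) : ℝ) / ρ) : ℂ) =
      peakTerm ρ n * w ^ n *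
        (((∏ i ∈ Finset.range j, ratioRight ρ n i : ℝ) : ℂ) * w ^ j) := by
  have hG : ∀ k : ℕ, (Real.Gamma (1 + (k : ℝ) / ρ) : ℂ) ≠ 0 := fun k => by
    exact_mod_cast (Gamma_coeff_pos hρ k).ne'
  have h1 := hG n
  have h2 := hG (n + j)
  rw [prod_ratioRight hρ, peakTerm, Complex.ofReal_div, Complex.ofReal_mul, Complex.ofReal_pow]
  generalize (Real.Gamma (1 + (n : ℝ) / ρ) : ℂ) = a at h1 ⊢
  generalize (Real.Gamma (1 + ((n + j : ℕ) : ℝ) / ρ) : ℂ) = b at h2 ⊢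
  field_simp
  ring

lemma mlTail_eq {ρ : ℝ} (hρ : 1 < ρ) (n : ℕ) {w : ℂ}
    (hs : Summable fun j : ℕ => ((∏ i ∈ Finset.range j, ratioRight ρ n i : ℝ) : ℂ) * w ^ j) :
    mlTail ρ (n + 1) (Rn ρ n * w) = peakTerm ρ n * w ^ n * (sumRight ρ n w - 1) := by
  have h : sumRight ρ n w - 1 =
      ∑' j : ℕ, ((∏ i ∈ Finset.range (j + 1), ratioRight ρ n i : ℝ) : ℂ) * w ^ (j + 1) := by
    rw [sumRight, hs.tsum_eq_zero_add]
    simp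
  rw [h, ← tsum_mul_left, mlTail]
  refine tsum_congr fun j => ?_
  rw [← term_add_eq hρ, show n + 1 + j = n + (j + 1) by ring]

lemma mlE_eq {ρ : ℝ} (hρ : 1 < ρ) (n : ℕ)
    (hs : Summable fun j : ℕ => ((∏ i ∈ Finset.range j, ratioRight ρ n i : ℝ) : ℂ) * 1 ^ j) :
    mlE ρ (Rn ρ n) = peakTerm ρ n * (sumLeft ρ n 1 + (sumRight ρ n 1 - 1)) := by
  have h1 := mlSec_eq hρ n one_ne_zero
  have h2 := mlTail_eq hρ n hs
  simp only [one_pow, mul_one, inv_one] at h1 h2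
  rw [mul_add, ← h1, ← h2, mlE, mlSec, mlTail]
  have hsum : Summable fun k : ℕ => (Rn ρ n : ℂ) ^ k / (Real.Gamma (1 + (k : ℝ) / ρ) : ℂ) := by
    rw [← summable_nat_add_iff n]
    refine (hs.mul_left (peakTerm ρ n)).congr fun j => ?_
    have := term_add_eq hρ n j 1
    simp only [one_pow, mul_one] at this ⊢
    rw [add_comm j n, this]
  rw [← hsum.sum_add_tsum_nat_add (n + 1)]
  congr 1
  refine tsum_congr fun j => ?_
  rw [add_comm j (n + 1)]

lemma normalized_mlI_eq {ρ : ℝ} (hρ : 1 < ρ) (lam : ℂ) (n : ℕ) {w : ℂ} (hw : w ≠ 0) {t : ℂ}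
    (ht : t ≠ 0)
    (hs1 : Summable fun j : ℕ => ((∏ i ∈ Finset.range j, ratioRight ρ n i : ℝ) : ℂ) * 1 ^ j)
    (hs : Summable fun j : ℕ => ((∏ i ∈ Finset.range j, ratioRight ρ n i : ℝ) : ℂ) * w ^ j) :
    (w⁻¹) ^ n * (mlE ρ (Rn ρ n))⁻¹ * mlI ρ lam n (Rn ρ n * w) =
      ((1 - lam) * (t * sumLeft ρ n w⁻¹) - lam * (t * sumRight ρ n w - t)) /
        (t * sumLeft ρ n 1 + (t * sumRight ρ n 1 - t)) := by
  have hP := peakTerm_ne_zero hρ n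
  have hwn : w ^ n ≠ 0 := pow_ne_zero n hw
  rw [mlI, mlSec_eq hρ n hw, mlTail_eq hρ n hs, mlE_eq hρ n hs1]
  have e1 : (1 - lam) * (t * sumLeft ρ n w⁻¹) - lam * (t * sumRight ρ n w - t)
      = t * ((1 - lam) * sumLeft ρ n w⁻¹ - lam * (sumRight ρ n w - 1)) := by ring
  have e2 : t * sumLeft ρ n 1 + (t * sumRight ρ n 1 - t)
      = t * (sumLeft ρ n 1 + (sumRight ρ n 1 - 1)) := by ring
  have e3 : (1 - lam) * (peakTerm ρ n * w ^ n * sumLeft ρ n w⁻¹)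
      - lam * (peakTerm ρ n * w ^ n * (sumRight ρ n w - 1))
      = peakTerm ρ n * w ^ n * ((1 - lam) * sumLeft ρ n w⁻¹ - lam * (sumRight ρ n w - 1)) := by
    ring
  rw [e1, e2, e3, mul_div_mul_left _ _ ht, div_eq_mul_inv, mul_inv, inv_pow]
  field_simp

lemma continuous_exp_mul_erfc : Continuous fun ζ : ℂ => Complex.exp (ζ ^ 2) * erfc ζ := by
  have hq : (Real.sqrt (π / 2) : ℂ) ≠ 0 := by
    exact_mod_cast (Real.sqrt_pos.2 (by positivity)).ne'
  have hc : Continuous halfGauss :=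
    continuous_iff_continuousAt.2 fun c => (hasDerivAt_halfGauss c).continuousAt
  have h : (fun ζ : ℂ => Complex.exp (ζ ^ 2) * erfc ζ) =
      fun ζ => halfGauss (-(Real.sqrt 2 : ℂ) * ζ) / (Real.sqrt (π / 2) : ℂ) := by
    funext ζ
    rw [halfGauss_eq_erfc]
    field_simp
  rw [h]
  fun_prop

lemma tendsto_sumLeft {ρ : ℝ} (hρ : 1 < ρ) {l : Filter (ℕ × ℂ)} [l.IsCountablyGenerated]
    (hl : Tendsto Prod.fst l atTop) {v : ℕ × ℂ → ℂ} {c : ℂ}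
    (hv : Tendsto (fun p => (Real.sqrt (ρ * p.1) : ℂ) * (v p - 1)) l (𝓝 c)) :
    (∀ᶠ p in l, Summable fun j : ℕ =>
        ((∏ i ∈ Finset.range j, ratioLeft ρ p.1 i : ℝ) : ℂ) * v p ^ j) ∧
      Tendsto (fun p => (Real.sqrt (ρ * p.1) : ℂ)⁻¹ * sumLeft ρ p.1 (v p)) l (𝓝 (halfGauss c)) := by
  have hτ : Tendsto (fun p : ℕ × ℂ => Real.sqrt (ρ * p.1)) l atTop :=
    (tendsto_sqrt_mul_natCast (by linarith)).comp hl
  have hr : ∀ X : ℝ, ∃ C : ℝ, ∀ᶠ p in l, ∀ i : ℕ, (i : ℝ) ≤ X * Real.sqrt (ρ * p.1) →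
      Real.exp (-(i / Real.sqrt (ρ * p.1) ^ 2) - C / Real.sqrt (ρ * p.1) ^ 2) ≤
          ratioLeft ρ p.1 i ∧
        ratioLeft ρ p.1 i ≤
          Real.exp (-(i / Real.sqrt (ρ * p.1) ^ 2) + C / Real.sqrt (ρ * p.1) ^ 2) := fun X =>
    (ratioLeft_bounds hρ X).imp fun C hC => hl.eventually hC
  unfold sumLeft halfGauss
  have h := tendsto_sum_prod_mul_pow (τ := fun p : ℕ × ℂ => Real.sqrt (ρ * p.1))
    (r := fun p => ratioLeft ρ p.1) hτ
    (Eventually.of_forall fun p => ratioLeft_nonneg hρ p.1)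
    (Eventually.of_forall fun p => ratioLeft_le_one hρ p.1)
    (Eventually.of_forall fun p => ratioLeft_antitone hρ p.1) hr hv
  exact h

lemma tendsto_sumRight {ρ : ℝ} (hρ : 1 < ρ) {l : Filter (ℕ × ℂ)} [l.IsCountablyGenerated]
    (hl : Tendsto Prod.fst l atTop) {v : ℕ × ℂ → ℂ} {c : ℂ}
    (hv : Tendsto (fun p => (Real.sqrt (ρ * p.1) : ℂ) * (v p - 1)) l (𝓝 c)) :
    (∀ᶠ p in l, Summable fun j : ℕ =>
        ((∏ i ∈ Finset.range j, ratioRight ρ p.1 i : ℝ) : ℂ) * v p ^ j) ∧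
      Tendsto (fun p => (Real.sqrt (ρ * p.1) : ℂ)⁻¹ * sumRight ρ p.1 (v p)) l (𝓝 (halfGauss c)) := by
  have hτ : Tendsto (fun p : ℕ × ℂ => Real.sqrt (ρ * p.1)) l atTop :=
    (tendsto_sqrt_mul_natCast (by linarith)).comp hl
  have hr : ∀ X : ℝ, ∃ C : ℝ, ∀ᶠ p in l, ∀ i : ℕ, (i : ℝ) ≤ X * Real.sqrt (ρ * p.1) →
      Real.exp (-(i / Real.sqrt (ρ * p.1) ^ 2) - C / Real.sqrt (ρ * p.1) ^ 2) ≤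
          ratioRight ρ p.1 i ∧
        ratioRight ρ p.1 i ≤
          Real.exp (-(i / Real.sqrt (ρ * p.1) ^ 2) + C / Real.sqrt (ρ * p.1) ^ 2) := fun X =>
    (ratioRight_bounds hρ X).imp fun C hC => hl.eventually hC
  unfold sumRight halfGauss
  have h := tendsto_sum_prod_mul_pow (τ := fun p : ℕ × ℂ => Real.sqrt (ρ * p.1))
    (r := fun p => ratioRight ρ p.1) hτ
    (Eventually.of_forall fun p => ratioRight_nonneg hρ p.1)
    (Eventually.of_forall fun p => ratioRight_le_one hρ p.1)
    (Eventually.of_forall fun p => ratioRight_antitone hρ p.1) hr hv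
  exact h

/-- Joint convergence of the normalised function in `n → ∞` and `ζ → ζ₀`. -/
lemma tendsto_normalized_mlI {ρ : ℝ} (hρ : 1 < ρ) (lam ζ₀ : ℂ) :
    Tendsto (fun p : ℕ × ℂ =>
        ((1 + (Real.sqrt (2 / (ρ * p.1)) : ℂ) * p.2)⁻¹) ^ p.1 * (mlE ρ (Rn ρ p.1 : ℂ))⁻¹ *
          mlI ρ lam p.1 ((Rn ρ p.1 : ℂ) * (1 + (Real.sqrt (2 / (ρ * p.1)) : ℂ) * p.2)))
      (atTop ×ˢ 𝓝 ζ₀) (𝓝 (Complex.exp (ζ₀ ^ 2) * (erfc ζ₀ / 2 - lam))) := by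
  have hρ0 : 0 < ρ := by linarith
  set l : Filter (ℕ × ℂ) := atTop ×ˢ 𝓝 ζ₀
  set τ : ℕ × ℂ → ℝ := fun p => Real.sqrt (ρ * p.1) with hτdef
  set w : ℕ × ℂ → ℂ := fun p => 1 + (Real.sqrt (2 / (ρ * p.1)) : ℂ) * p.2 with hwdef
  have hτ : Tendsto τ l atTop := (tendsto_sqrt_mul_natCast hρ0).comp tendsto_fst
  have hτ0 : ∀ᶠ p in l, (τ p : ℂ) ≠ 0 := by
    filter_upwards [hτ.eventually_gt_atTop 0] with p hp
    exact_mod_cast hp.ne'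
  have hinv : Tendsto (fun p => ((τ p : ℂ))⁻¹) l (𝓝 0) := by
    have := (Complex.continuous_ofReal.tendsto 0).comp hτ.inv_tendsto_atTop
    simpa [Function.comp_def] using this
  have hv1 : Tendsto (fun p => (τ p : ℂ) * ((1 : ℂ) - 1)) l (𝓝 0) := by simp
  have hw : Tendsto (fun p => (τ p : ℂ) * (w p - 1)) l (𝓝 ((Real.sqrt 2 : ℂ) * ζ₀)) := by
    have h : Tendsto (fun p : ℕ × ℂ => (Real.sqrt 2 : ℂ) * p.2) l (𝓝 ((Real.sqrt 2 : ℂ) * ζ₀)) :=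
      tendsto_snd.const_mul _
    refine h.congr' ?_
    filter_upwards [hτ0] with p hp
    have : (Real.sqrt (2 / (ρ * p.1)) : ℂ) = (Real.sqrt 2 : ℂ) / τ p := by
      rw [Real.sqrt_div (by norm_num), Complex.ofReal_div]
    simp only [hwdef, this]
    field_simp
    ring
  have hw1 : Tendsto w l (𝓝 1) := by
    have h := (hinv.mul hw).add_const 1
    rw [zero_mul, zero_add] at h
    refine h.congr' ?_
    filter_upwards [hτ0] with p hp
    field_simp
    ring
  have hw0 : ∀ᶠ p in l, w p ≠ 0 := hw1.eventually_ne one_ne_zero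
  have hwi : Tendsto (fun p => (τ p : ℂ) * ((w p)⁻¹ - 1)) l (𝓝 (-(Real.sqrt 2 : ℂ) * ζ₀)) := by
    have h := hw.neg.mul (hw1.inv₀ one_ne_zero)
    rw [inv_one, mul_one, ← neg_mul] at h
    refine h.congr' ?_
    filter_upwards [hw0] with p hp
    field_simp
    ring
  have hq : (Real.sqrt (π / 2) : ℂ) ≠ 0 := by
    exact_mod_cast (Real.sqrt_pos.2 (by positivity)).ne'
  have hG0 : halfGauss 0 + (halfGauss 0 - 0) ≠ 0 := by
    rw [halfGauss_zero, sub_zero, ← two_mul]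
    exact mul_ne_zero two_ne_zero hq
  have hmain := (((tendsto_sumLeft hρ tendsto_fst hwi).2.const_mul (1 - lam)).sub
    (((tendsto_sumRight hρ tendsto_fst hw).2.sub hinv).const_mul lam)).div
      ((tendsto_sumLeft hρ tendsto_fst hv1).2.add ((tendsto_sumRight hρ tendsto_fst hv1).2.sub hinv)) hG0
  have hlimit : ((1 - lam) * halfGauss (-(Real.sqrt 2 : ℂ) * ζ₀)
      - lam * (halfGauss ((Real.sqrt 2 : ℂ) * ζ₀) - 0)) / (halfGauss 0 + (halfGauss 0 - 0))
      = Complex.exp (ζ₀ ^ 2) * (erfc ζ₀ / 2 - lam) := by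
    have h := halfGauss_eq_erfc (-ζ₀)
    rw [neg_mul_neg, erfc_neg, neg_sq] at h
    rw [h, halfGauss_eq_erfc, halfGauss_zero]
    field_simp
    ring
  rw [← hlimit]
  refine Tendsto.congr' ?_ hmain
  filter_upwards [hw0, hτ0, (tendsto_sumRight hρ tendsto_fst hv1).1, (tendsto_sumRight hρ tendsto_fst hw).1] with p hp hτp hs1 hs
  exact (normalized_mlI_eq hρ lam p.1 hp (inv_ne_zero hτp) hs1 hs).symm

theorem stmt8 (ρ : ℝ) (hρ : 1 < ρ) (lam : ℂ) (K : Set ℂ) (hK : IsCompact K) :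
    TendstoUniformlyOn
      (fun (n : ℕ) (ζ : ℂ) =>
        ((1 + (Real.sqrt (2 / (ρ * n)) : ℂ) * ζ)⁻¹) ^ n * (mlE ρ ((Rn ρ n : ℂ)))⁻¹ *
          mlI ρ lam n ((Rn ρ n : ℂ) * (1 + (Real.sqrt (2 / (ρ * n)) : ℂ) * ζ)))
      (fun ζ => Complex.exp (ζ ^ 2) * (erfc ζ / 2 - lam)) atTop K := by
  rw [← tendstoLocallyUniformlyOn_iff_tendstoUniformlyOn_of_compact hK,
    tendstoLocallyUniformlyOn_iff_forall_tendsto]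
  intro ζ₀ _
  have hcont : Continuous fun ζ : ℂ => Complex.exp (ζ ^ 2) * (erfc ζ / 2 - lam) := by
    have h : (fun ζ : ℂ => Complex.exp (ζ ^ 2) * (erfc ζ / 2 - lam)) =
        fun ζ => Complex.exp (ζ ^ 2) * erfc ζ / 2 - Complex.exp (ζ ^ 2) * lam := by
      funext ζ
      ring
    rw [h]
    exact (continuous_exp_mul_erfc.div_const 2).sub (by fun_prop)
  have h1 : Tendsto (fun p : ℕ × ℂ => Complex.exp (p.2 ^ 2) * (erfc p.2 / 2 - lam))
      (atTop ×ˢ 𝓝 ζ₀) (𝓝 (Complex.exp (ζ₀ ^ 2) * (erfc ζ₀ / 2 - lam))) :=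
    (hcont.tendsto ζ₀).comp tendsto_snd
  exact ((h1.prodMk_nhds (tendsto_normalized_mlI hρ lam ζ₀)).mono_right
    (nhds_le_uniformity _)).mono_left (Filter.prod_mono le_rfl nhdsWithin_le_nhds)
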